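/- arXiv:1501.00355 — 2 statements merged into one kernel-verified Lean document; each statement's English description precedes it below -/
import Mathlib

section
/- Let b > 1 and β > 0 be constants and define ψ^{(b,β)}(p) = (b − p)^{−β} for 1 ≤ p < b, so that the fundamental function of the corresponding Bilateral Grand Lebesgue Space is φ(Gψ^{(b,β)}, δ) = sup_{1 ≤ p < b} δ^{1/p} (b − p)^{β}. Then φ(Gψ^{(b,β)}, δ) is asymptotically equivalent, as δ → 0+, to (β b²/e)^{β} · δ^{1/b} · |ln δ|^{−β}; that is, lim_{δ → 0+} [sup_{1 ≤ p < b} δ^{1/p} (b − p)^{β}] / [(β b²/e)^{β} δ^{1/b} |ln δ|^{−β}] = 1. -/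
open Set Filter

lemma ffa_den (b β δ : ℝ) (hb : 1 < b) (hβ : 0 < β) (h0 : 0 < δ) (h1 : δ < 1) :
    (β * b ^ 2 / Real.exp 1) ^ β * δ ^ (1 / b) * |Real.log δ| ^ (-β) =
      Real.exp (β * (Real.log (β * b ^ 2) - 1) + Real.log δ / b
        - β * Real.log (- Real.log δ)) := by
  have hl : Real.log δ < 0 := Real.log_neg h0 h1
  have hb0 : 0 < b := by linarith
  rw [abs_of_neg hl, Real.rpow_def_of_pos (by positivity), Real.rpow_def_of_pos h0,
    Real.rpow_def_of_pos (by linarith), ← Real.exp_add, ← Real.exp_add,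
    Real.log_div (by positivity) (by positivity), Real.log_exp]
  congr 1
  ring

lemma ffa_num (b β δ p : ℝ) (hp : p < b) (h0 : 0 < δ) :
    δ ^ (1 / p) * (b - p) ^ β = Real.exp (Real.log δ / p + β * Real.log (b - p)) := by
  rw [Real.rpow_def_of_pos h0, Real.rpow_def_of_pos (by linarith), ← Real.exp_add]
  congr 1
  ring

lemma ffa_upper (b β δ p : ℝ) (hb : 1 < b) (hβ : 0 < β) (h0 : 0 < δ) (h1 : δ < 1)
    (hp1 : 1 ≤ p) (hp : p < b) :
    δ ^ (1 / p) * (b - p) ^ β ≤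
      (β * b ^ 2 / Real.exp 1) ^ β * δ ^ (1 / b) * |Real.log δ| ^ (-β) := by
  rw [ffa_den b β δ hb hβ h0 h1, ffa_num b β δ p hp h0]
  apply Real.exp_le_exp.2
  have hl : Real.log δ < 0 := Real.log_neg h0 h1
  obtain ⟨L, hL⟩ : ∃ L, L = - Real.log δ := ⟨_, rfl⟩
  have hlog : Real.log δ = -L := by linarith
  have hL0 : 0 < L := by linarith
  rw [hlog, neg_neg]
  have hb0 : 0 < b := by linarith
  have hp0 : 0 < p := by linarith
  have ht : 0 < b - p := by linarith
  have key := Real.log_le_sub_one_of_pos (x := (b - p) * L / (β * b ^ 2)) (by positivity)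
  rw [Real.log_div (by positivity) (by positivity), Real.log_mul (by positivity) (by positivity)]
    at key
  have key2 := mul_le_mul_of_nonneg_left key hβ.le
  have e1 : β * ((b - p) * L / (β * b ^ 2) - 1) = (b - p) * L / b ^ 2 - β := by
    field_simp
  have e2 : (b - p) * L / b ^ 2 ≤ L / p - L / b := by
    have : L / p - L / b = (b - p) * L / (p * b) := by field_simp
    rw [this]
    apply div_le_div_of_nonneg_left (by positivity) (by positivity)
    nlinarith
  rw [e1] at key2
  have e3 : -L / p = -(L / p) := by ring
  have e4 : -L / b = -(L / b) := by ring
  rw [e3, e4]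
  linarith

/-- **Example 1.1.**  For `b > 1`, `β > 0` and `ψ^{(b,β)}(p) = (b-p)^{-β}` on `[1,b)`,
the fundamental function `φ(Gψ^{(b,β)}, δ) = sup_{1 ≤ p < b} δ^{1/p} (b-p)^β`
satisfies `φ(Gψ^{(b,β)}, δ) ∼ (β b²/e)^β · δ^{1/b} · |ln δ|^{-β}` as `δ → 0+`. -/
theorem fundamental_function_asymptotics_power
    (b β : ℝ) (hb : 1 < b) (hβ : 0 < β) :
    Tendsto
      (fun δ : ℝ =>
        (⨆ p : {p : ℝ // 1 ≤ p ∧ p < b}, δ ^ (1 / (p : ℝ)) * (b - (p : ℝ)) ^ β) /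
          ((β * b ^ 2 / Real.exp 1) ^ β * δ ^ (1 / b) * |Real.log δ| ^ (-β)))
      (nhdsWithin 0 (Ioi 0)) (nhds 1) := by
  have hb0 : 0 < b := by linarith
  have hLt : Tendsto (fun δ : ℝ => - Real.log δ) (nhdsWithin 0 (Ioi 0)) atTop :=
    tendsto_neg_atBot_atTop.comp Real.tendsto_log_nhdsGT_zero
  have hpt : Tendsto (fun δ : ℝ => b - β * b ^ 2 / (- Real.log δ))
      (nhdsWithin 0 (Ioi 0)) (nhds b) := by
    simpa using (tendsto_const_nhds (x := b)).sub (hLt.const_div_atTop (β * b ^ 2))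
  have hlow : Tendsto (fun δ : ℝ => Real.exp (β - β * b / (b - β * b ^ 2 / (- Real.log δ))))
      (nhdsWithin 0 (Ioi 0)) (nhds 1) := by
    have := (Real.continuous_exp.tendsto _).comp ((tendsto_const_nhds (x := β)).sub
      ((tendsto_const_nhds (x := β * b)).div hpt hb0.ne'))
    have e : Real.exp (β - β * b / b) = 1 := by
      rw [mul_div_assoc, div_self hb0.ne']; simp
    rw [e] at this
    exact this
  have hd0 : ∀ᶠ δ : ℝ in nhdsWithin 0 (Ioi 0), 0 < δ := self_mem_nhdsWithin
  have hd1 : ∀ᶠ δ : ℝ in nhdsWithin 0 (Ioi 0), δ < 1 :=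
    mem_nhdsWithin_of_mem_nhds (Iio_mem_nhds one_pos)
  have hp1 := hpt.eventually (lt_mem_nhds hb)
  have : Nonempty {p : ℝ // 1 ≤ p ∧ p < b} := ⟨⟨1, le_refl _, hb⟩⟩
  refine tendsto_of_tendsto_of_tendsto_of_le_of_le' hlow tendsto_const_nhds ?_ ?_
  · filter_upwards [hd0, hd1, hp1] with δ h0 h1 hp
    have hbdd : BddAbove (range fun p : {p : ℝ // 1 ≤ p ∧ p < b} =>
        δ ^ (1 / (p : ℝ)) * (b - (p : ℝ)) ^ β) := by
      refine ⟨(β * b ^ 2 / Real.exp 1) ^ β * δ ^ (1 / b) * |Real.log δ| ^ (-β), ?_⟩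
      · rintro _ ⟨p, rfl⟩
        exact ffa_upper b β δ p hb hβ h0 h1 p.2.1 p.2.2
    have hl : Real.log δ < 0 := Real.log_neg h0 h1
    have hpb : b - β * b ^ 2 / (- Real.log δ) < b := by
      have : 0 < β * b ^ 2 / (- Real.log δ) := div_pos (by positivity) (by linarith)
      linarith
    have hle := le_ciSup hbdd ⟨_, hp.le, hpb⟩
    refine le_trans ?_ (div_le_div_of_nonneg_right hle ?_)
    · rw [ffa_den b β δ hb hβ h0 h1]
      simp only
      rw [ffa_num b β δ _ hpb h0, ← Real.exp_sub]
      apply le_of_eq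
      congr 1
      obtain ⟨L, hL⟩ : ∃ L, L = - Real.log δ := ⟨_, rfl⟩
      have hlog : Real.log δ = -L := by linarith
      have hL0 : 0 < L := by linarith
      rw [hlog, neg_neg] at hp ⊢
      obtain ⟨p, hpe⟩ : ∃ p, p = b - β * b ^ 2 / L := ⟨_, rfl⟩
      have e : b - p = β * b ^ 2 / L := by rw [hpe]; ring
      rw [← hpe] at hp ⊢
      rw [e, Real.log_div (by positivity) (by positivity)]
      have hp0 : p ≠ 0 := by linarith
      have e2 : (b - p) * L = β * b ^ 2 := by rw [e]; field_simp
      have e3 : L / p - L / b = β * b / p := by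
        field_simp
        linear_combination e2
      rw [← e3]
      ring
    · rw [ffa_den b β δ hb hβ h0 h1]; positivity
  · filter_upwards [hd0, hd1] with δ h0 h1
    apply div_le_one_of_le₀
    · exact ciSup_le fun p => ffa_upper b β δ p hb hβ h0 h1 p.2.1 p.2.2
    · rw [ffa_den b β δ hb hβ h0 h1]; positivity
end

section
/- Let β > 0 be a constant and define ψ_{(β)}(p) = p^{β} for 1 ≤ p < ∞, so that the fundamental function of the corresponding Bilateral Grand Lebesgue Space is φ(Gψ_{(β)}, δ) = sup_{1 ≤ p < ∞} δ^{1/p} p^{−β}. Then φ(Gψ_{(β)}, δ) is asymptotically equivalent, as δ → 0+, to (β/e)^{β} · |ln δ|^{−β}; that is, lim_{δ → 0+} [sup_{1 ≤ p < ∞} δ^{1/p} p^{−β}] · |ln δ|^{β} = (β/e)^{β}. -/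
open Set Filter

/-- **Example 1.2.**  For `β > 0` and `ψ_{(β)}(p) = p^β` on `[1,∞)`, the fundamental
function `φ(Gψ_{(β)}, δ) = sup_{1 ≤ p < ∞} δ^{1/p} p^{-β}` satisfies
`φ(Gψ_{(β)}, δ) ∼ (β/e)^β · |ln δ|^{-β}` as `δ → 0+`. -/
theorem fundamental_function_asymptotics_exponential
    (β : ℝ) (hβ : 0 < β) :
    Tendsto
      (fun δ : ℝ =>
        (⨆ p : {p : ℝ // 1 ≤ p}, δ ^ (1 / (p : ℝ)) * (p : ℝ) ^ (-β)) *
          |Real.log δ| ^ β)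
      (nhdsWithin 0 (Ioi 0)) (nhds ((β / Real.exp 1) ^ β)) := by
  have hev : ∀ᶠ δ : ℝ in nhdsWithin 0 (Ioi 0), 0 < δ ∧ δ < Real.exp (-β) := by
    have := Ioo_mem_nhdsGT (Real.exp_pos (-β))
    filter_upwards [this] with δ h using h
  refine tendsto_const_nhds.congr' ?_
  filter_upwards [hev] with δ hδ
  obtain ⟨h0, h1⟩ := hδ
  have hlog : Real.log δ < -β := (Real.log_lt_iff_lt_exp h0).2 h1
  obtain ⟨L, hL⟩ : ∃ L, L = -Real.log δ := ⟨_, rfl⟩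
  have hLβ : β < L := by linarith
  have hL0 : 0 < L := by linarith
  have hlogδ : Real.log δ = -L := by linarith
  have hterm : ∀ p : ℝ, 1 ≤ p → δ ^ (1 / p) * p ^ (-β)
      = Real.exp (-(L / p) - β * Real.log p) := by
    intro p hp
    rw [Real.rpow_def_of_pos h0, Real.rpow_def_of_pos (by linarith), ← Real.exp_add, hlogδ]
    congr 1
    ring
  have hle : ∀ p : {p : ℝ // 1 ≤ p}, δ ^ (1 / (p : ℝ)) * (p : ℝ) ^ (-β)
      ≤ Real.exp (β * Real.log β - β - β * Real.log L) := by
    rintro ⟨p, hp⟩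
    have hp0 : 0 < p := by linarith
    simp only
    rw [hterm p hp, Real.exp_le_exp]
    have h2 := Real.log_le_sub_one_of_pos (show 0 < L / p / β by positivity)
    rw [Real.log_div (by positivity) hβ.ne', Real.log_div hL0.ne' hp0.ne'] at h2
    have h3 := mul_le_mul_of_nonneg_left h2 hβ.le
    have h4 : β * (L / p / β - 1) = L / p - β := by field_simp
    rw [h4] at h3
    linarith
  have hsup : (⨆ p : {p : ℝ // 1 ≤ p}, δ ^ (1 / (p : ℝ)) * (p : ℝ) ^ (-β))
      = Real.exp (β * Real.log β - β - β * Real.log L) := by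
    have hp : 1 ≤ L / β := by rw [le_div_iff₀ hβ]; linarith
    haveI : Nonempty {p : ℝ // 1 ≤ p} := ⟨⟨_, hp⟩⟩
    refine le_antisymm (ciSup_le hle) ?_
    have hb : BddAbove (range fun p : {p : ℝ // 1 ≤ p} =>
        δ ^ (1 / (p : ℝ)) * (p : ℝ) ^ (-β)) := ⟨_, by rintro _ ⟨p, rfl⟩; exact hle p⟩
    refine le_trans (le_of_eq ?_) (le_ciSup hb ⟨L / β, hp⟩)
    simp only
    rw [hterm _ hp, Real.log_div hL0.ne' hβ.ne']
    congr 1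
    field_simp
    ring
  rw [hsup, hlogδ, abs_neg, abs_of_pos hL0, Real.rpow_def_of_pos hL0, ← Real.exp_add,
    Real.rpow_def_of_pos (by positivity), Real.log_div hβ.ne' (Real.exp_pos 1).ne', Real.log_exp]
  congr 1
  ring
end
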